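/- Let d ≥ 1 and C ≥ 1, let a_1, …, a_C ∈ ℝᵈ and b_1, …, b_C ∈ ℝ, and for w ∈ ℝᵈ define the softmax probability p(w)_i = exp(a_i·w + b_i) / Σ_{j=1}^C exp(a_j·w + b_j). Fix z ∈ ℝᵈ and σ ∈ ℝᵈ with σ_k ≥ 0, let Σ = diag(σ₁²,…,σ_d²), and let Z̃ be a random vector in ℝᵈ distributed according to the product measure ⊗_{k=1}^d N(z_k, σ_k²). Then the expected Kullback–Leibler divergence from the center prediction to the regional predictions satisfies E[ KL( p(z) ‖ p(Z̃) ) ] ≤ Σ_{j=1}^C p(z)_j · log Σ_{i=1}^C p(z)_i · exp( (1/2)(a_i − a_j)Σ(a_i − a_j)ᵀ ), where for u ∈ ℝᵈ we write uΣuᵀ = Σ_{k=1}^d u_k² σ_k². The right-hand side is the paper's Regional Instability L_RI(z). -/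

import Mathlib

open Real BigOperators Finset MeasureTheory ProbabilityTheory

/-- The softmax prediction probability `p(w)_i = exp(a_i·w + b_i) / ∑_j exp(a_j·w + b_j)`. -/
noncomputable def softmax {d C : ℕ} (a : Fin C → Fin d → ℝ) (b : Fin C → ℝ)
    (w : Fin d → ℝ) (i : Fin C) : ℝ :=
  Real.exp ((∑ k, a i k * w k) + b i) / ∑ j, Real.exp ((∑ k, a j k * w k) + b j)

section Softmax

variable {d C : ℕ} (a : Fin C → Fin d → ℝ) (b : Fin C → ℝ)

lemma sum_exp_pos (w : Fin d → ℝ) (i : Fin C) :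
    0 < ∑ j, Real.exp ((∑ k, a j k * w k) + b j) :=
  Finset.sum_pos (fun _ _ => Real.exp_pos _) ⟨i, Finset.mem_univ i⟩

lemma softmax_pos (w : Fin d → ℝ) (i : Fin C) : 0 < softmax a b w i :=
  div_pos (Real.exp_pos _) (sum_exp_pos a b w i)

lemma sum_softmax (w : Fin d → ℝ) (hC : 1 ≤ C) : ∑ i, softmax a b w i = 1 := by
  unfold softmax
  rw [← Finset.sum_div]
  exact div_self (sum_exp_pos a b w ⟨0, hC⟩).ne'

lemma softmax_div_softmax (z w : Fin d → ℝ) (j : Fin C) :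
    softmax a b z j / softmax a b w j =
      ∑ i, softmax a b z i * Real.exp (∑ k, (a i k - a j k) * (w k - z k)) := by
  have hz := (sum_exp_pos a b z j).ne'
  have hw := (sum_exp_pos a b w j).ne'
  have key (i : Fin C) : Real.exp ((∑ k, a j k * z k) + b j) *
      Real.exp ((∑ k, a i k * w k) + b i) = Real.exp ((∑ k, a i k * z k) + b i) *
        Real.exp (∑ k, (a i k - a j k) * (w k - z k)) *
          Real.exp ((∑ k, a j k * w k) + b j) := by
    simp only [← Real.exp_add]
    congr 1
    simp only [sub_mul, mul_sub, Finset.sum_sub_distrib]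
    ring
  unfold softmax
  rw [div_div_div_eq, div_eq_iff (mul_ne_zero hz (Real.exp_pos _).ne'), Finset.mul_sum,
    Finset.sum_mul]
  refine Finset.sum_congr rfl fun i _ => ?_
  rw [key]
  field_simp

end Softmax

/-- **Gibbs' inequality** on a finite type. -/
lemma sum_mul_log_div_nonneg {ι : Type*} [Fintype ι] {p q : ι → ℝ} (hp : ∀ i, 0 < p i)
    (hq : ∀ i, 0 < q i) (h : ∑ i, q i ≤ ∑ i, p i) : 0 ≤ ∑ i, p i * Real.log (p i / q i) := by
  calc 0 ≤ ∑ i, (p i - q i) := by rw [Finset.sum_sub_distrib]; linarith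
    _ ≤ _ := Finset.sum_le_sum fun i _ => by
      have h1 := Real.one_sub_inv_le_log_of_pos (div_pos (hp i) (hq i))
      rw [inv_div] at h1
      calc p i - q i = p i * (1 - q i / p i) := by field_simp [(hp i).ne']
        _ ≤ _ := mul_le_mul_of_nonneg_left h1 (hp i).le

lemma Real.log_le_log_add_div_sub_one {x m : ℝ} (hx : 0 < x) (hm : 0 < m) :
    Real.log x ≤ Real.log m + (x / m - 1) := by
  have h := Real.log_le_sub_one_of_pos (div_pos hx hm)
  rw [Real.log_div hx.ne' hm.ne'] at h
  linarith

section Gaussian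

open scoped NNReal

lemma integrable_exp_mul_sub_gaussianReal (m : ℝ) (v : ℝ≥0) (t : ℝ) :
    Integrable (fun x => Real.exp (t * (x - m))) (gaussianReal m v) := by
  simp only [mul_sub, Real.exp_sub]
  exact (integrable_exp_mul_gaussianReal t).div_const _

lemma integral_exp_mul_sub_gaussianReal (m : ℝ) (v : ℝ≥0) (t : ℝ) :
    ∫ x, Real.exp (t * (x - m)) ∂gaussianReal m v = Real.exp (v * t ^ 2 / 2) := by
  have h := congrFun (mgf_id_gaussianReal (μ := m) (v := v)) t
  simp only [mgf, id] at h
  simp only [mul_sub, Real.exp_sub]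
  rw [integral_div, h, ← Real.exp_sub]
  congr 1
  ring

variable {ι : Type*} [Fintype ι] (m : ι → ℝ) (v : ι → ℝ≥0) (u : ι → ℝ)

lemma integrable_exp_sum_mul_sub_pi_gaussianReal :
    Integrable (fun w : ι → ℝ => Real.exp (∑ k, u k * (w k - m k)))
      (Measure.pi fun k => gaussianReal (m k) (v k)) := by
  simp only [Real.exp_sum]
  exact Integrable.fintype_prod_dep fun k => integrable_exp_mul_sub_gaussianReal _ _ (u k)

lemma integral_exp_sum_mul_sub_pi_gaussianReal :
    ∫ w : ι → ℝ, Real.exp (∑ k, u k * (w k - m k))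
      ∂(Measure.pi fun k => gaussianReal (m k) (v k)) =
        Real.exp ((1 / 2) * ∑ k, u k ^ 2 * v k) := by
  simp only [Real.exp_sum]
  rw [integral_fintype_prod_eq_prod (fun k x => Real.exp (u k * (x - m k)))]
  simp only [integral_exp_mul_sub_gaussianReal]
  rw [← Real.exp_sum, Finset.mul_sum]
  congr 1
  exact Finset.sum_congr rfl fun k _ => by ring

end Gaussian

/-- **Proposition 2 (Efficient Metric of Variance Term).**
If `Z̃ ~ ⊗ₖ N(z k, (σ k)²)` (diagonal covariance `Σ = diag(σ₁², …, σ_d²)`), then the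
expected KL divergence from the center prediction to the regional predictions is bounded
by the Regional Instability
`L_RI(z) = ∑_j p(z)_j · log ∑_i p(z)_i · exp(½ (a_i − a_j) Σ (a_i − a_j)ᵀ)`. -/
theorem expected_kl_le_regional_instability (d C : ℕ) (hd : 1 ≤ d) (hC : 1 ≤ C)
    (a : Fin C → Fin d → ℝ) (b : Fin C → ℝ)
    (z σ : Fin d → ℝ) (hσ : ∀ k, 0 ≤ σ k) :
    ∫ w : Fin d → ℝ, (∑ i, softmax a b z i * Real.log (softmax a b z i / softmax a b w i))
        ∂(Measure.pi fun k => gaussianReal (z k) ⟨(σ k) ^ 2, sq_nonneg _⟩)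
      ≤ ∑ j, softmax a b z j *
          Real.log (∑ i, softmax a b z i *
            Real.exp ((1 / 2) * ∑ k, (a i k - a j k) ^ 2 * (σ k) ^ 2)) := by
  set P := softmax a b z with hP
  set v : Fin d → NNReal := fun k => ⟨(σ k) ^ 2, sq_nonneg _⟩
  set μ : Measure (Fin d → ℝ) := Measure.pi fun k => gaussianReal (z k) (v k)
  set M : Fin C → ℝ := fun j => ∑ i, P i *
    Real.exp ((1 / 2) * ∑ k, (a i k - a j k) ^ 2 * (σ k) ^ 2)
  have hPpos : ∀ i, 0 < P i := softmax_pos a b z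
  have hMpos (j : Fin C) : 0 < M j :=
    Finset.sum_pos (fun i _ => mul_pos (hPpos i) (Real.exp_pos _)) ⟨j, Finset.mem_univ j⟩
  have hint_exp (i j : Fin C) :
      Integrable (fun w => P i * Real.exp (∑ k, (a i k - a j k) * (w k - z k))) μ :=
    (integrable_exp_sum_mul_sub_pi_gaussianReal z v fun k => a i k - a j k).const_mul _
  have hint (j : Fin C) : Integrable (fun w => P j / softmax a b w j) μ := by
    simp only [hP, softmax_div_softmax]
    exact integrable_finsetSum _ fun i _ => hint_exp i j
  have hmean (j : Fin C) : ∫ w, P j / softmax a b w j ∂μ = M j := by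
    simp only [hP, softmax_div_softmax]
    rw [integral_finsetSum _ fun i _ => hint_exp i j]
    refine Finset.sum_congr rfl fun i _ => ?_
    rw [integral_const_mul, integral_exp_sum_mul_sub_pi_gaussianReal z v fun k => a i k - a j k]
    rfl
  have hdev (j : Fin C) : Integrable (fun w => P j / softmax a b w j / M j - 1) μ :=
    ((hint j).div_const _).sub (integrable_const _)
  have hbound (j : Fin C) : Integrable
      (fun w => P j * (Real.log (M j) + (P j / softmax a b w j / M j - 1))) μ :=
    ((integrable_const _).add (hdev j)).const_mul _
  calc _ ≤ ∫ w, ∑ j, P j * (Real.log (M j) + (P j / softmax a b w j / M j - 1)) ∂μ := by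
        refine integral_mono_of_nonneg (.of_forall fun w => ?_)
          (integrable_finsetSum _ fun j _ => hbound j) (.of_forall fun w => ?_)
        · exact sum_mul_log_div_nonneg hPpos (softmax_pos a b w)
            (by rw [hP, sum_softmax a b w hC, sum_softmax a b z hC])
        · exact Finset.sum_le_sum fun j _ => mul_le_mul_of_nonneg_left
            (Real.log_le_log_add_div_sub_one (div_pos (hPpos j) (softmax_pos a b w j)) (hMpos j))
            (hPpos j).le
    _ = ∑ j, P j * Real.log (M j) := by
        rw [integral_finsetSum _ fun j _ => hbound j]
        refine Finset.sum_congr rfl fun j _ => ?_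
        rw [integral_const_mul, integral_add (integrable_const _) (hdev j),
          integral_sub ((hint j).div_const _) (integrable_const _), integral_div, hmean,
          div_self (hMpos j).ne']
        simp
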